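/- arXiv:1406.5996 — 8 statements merged into one kernel-verified Lean document; each statement's English description precedes it below -/
import Mathlib

section
/- Let (ω,λ) be an equilibrium stress for a framework (G,p) on a family of concentric cylinders Y. Then C_Y(G,p) · Ω_Y(ω,λ) = 0, so each row of the configuration matrix C_Y(G,p) belongs to the cokernel of Ω_Y(ω,λ); consequently rank Ω_Y(ω,λ) ≤ 3n − rank C_Y(G,p), and if equality holds then the rows of C_Y(G,p) span the cokernel of Ω_Y(ω,λ). -/
open Finset

/-- The `n×n` matrix `Ω(ω)` with off-diagonal entries `-ω i j` and diagonal entries `∑ k, ω i k`. -/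
def omegaMat {n : ℕ} (ω : Fin n → Fin n → ℝ) : Matrix (Fin n) (Fin n) ℝ :=
  fun i j => if i = j then ∑ k, ω i k else -ω i j

/-- The `3n×3n` stress matrix `Ω_Y(ω,λ) = diag(Ω+Λ, Ω+Λ, Ω)` on a family of concentric
cylinders, indexed by `Fin 3 × Fin n` (coordinate block × vertex). -/
def stressMatY {n : ℕ} (ω : Fin n → Fin n → ℝ) (lam : Fin n → ℝ) :
    Matrix (Fin 3 × Fin n) (Fin 3 × Fin n) ℝ :=
  fun r c => if r.1 = c.1 then
      omegaMat ω r.2 c.2 + (if r.2 = c.2 ∧ r.1 ≠ 2 then lam r.2 else 0)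
    else 0

/-- `(ω,λ)` is an equilibrium stress for `(G,p)` on the family of concentric cylinders:
`∑_j ω_ij (p_i − p_j) + λ_i (x_i, y_i, 0) = 0` for all `i`. -/
def IsEquilStressY {n : ℕ} (p : Fin n → Fin 3 → ℝ)
    (ω : Fin n → Fin n → ℝ) (lam : Fin n → ℝ) : Prop :=
  ∀ i, ∀ a : Fin 3,
    (∑ j, ω i j * (p i a - p j a)) + lam i * (if a = 2 then 0 else p i a) = 0

/-- `(ω,λ)` is a stress for the graph `G`: `ω` is symmetric and supported on the edges. -/
def IsStress {n : ℕ} (G : SimpleGraph (Fin n)) (ω : Fin n → Fin n → ℝ) : Prop :=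
  (∀ i j, ω i j = ω j i) ∧ (∀ i j, ¬ G.Adj i j → ω i j = 0)

/-- The `6 × 3n` configuration matrix `C_Y(G,p)` for a framework on a family of
concentric cylinders, with rows `(x|0|0), (0|y|0), (0|0|z), (y|0|0), (0|x|0), (0|0|1)`. -/
def configMatY {n : ℕ} (p : Fin n → Fin 3 → ℝ) : Matrix (Fin 6) (Fin 3 × Fin n) ℝ :=
  Matrix.of ![
    fun c => if c.1 = 0 then p c.2 0 else 0,
    fun c => if c.1 = 1 then p c.2 1 else 0,
    fun c => if c.1 = 2 then p c.2 2 else 0,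
    fun c => if c.1 = 0 then p c.2 1 else 0,
    fun c => if c.1 = 1 then p c.2 0 else 0,
    fun c => if c.1 = 2 then 1 else 0]

/-- A row vector times the graph part of the stress matrix, for a stress of `G`. -/
lemma sum_mul_omegaMat {n : ℕ} {G : SimpleGraph (Fin n)} {ω : Fin n → Fin n → ℝ}
    (hω : IsStress G ω) (w : Fin n → ℝ) (j : Fin n) :
    ∑ i, w i * omegaMat ω i j = ∑ i, ω j i * (w j - w i) := by
  have hdiag : ω j j = 0 := hω.2 j j (G.irrefl)
  have hterm : ∀ i, w i * omegaMat ω i j =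
      (if i = j then w j * ∑ k, ω j k else 0) - ω j i * w i := by
    intro i
    by_cases h : i = j
    · subst h
      simp [omegaMat, hdiag]
    · simp only [omegaMat, h, if_false, hω.1 i j]
      ring
  simp only [hterm, mul_sub, Finset.sum_sub_distrib, Finset.sum_ite_eq', Finset.mem_univ, if_true,
    ← Finset.sum_mul]
  ring

/-- A vector supported on the coordinate block `b` is in the cokernel of the stress matrix if it
satisfies the equilibrium condition of that block. -/
lemma vecMul_stressMatY_block {n : ℕ} {G : SimpleGraph (Fin n)} {ω : Fin n → Fin n → ℝ}
    {lam : Fin n → ℝ} (hω : IsStress G ω) (b : Fin 3) (w : Fin n → ℝ)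
    (hw : ∀ j, (∑ i, ω j i * (w j - w i)) + lam j * (if b = 2 then 0 else w j) = 0) :
    Matrix.vecMul (fun c : Fin 3 × Fin n => if c.1 = b then w c.2 else 0)
      (stressMatY ω lam) = 0 := by
  ext ⟨d, j⟩
  simp only [Matrix.vecMul, dotProduct, Fintype.sum_prod_type, stressMatY, Pi.zero_apply,
    ite_mul, zero_mul]
  rw [Finset.sum_eq_single b (fun x _ hx => by simp [hx]) (by simp)]
  by_cases h : b = d
  · subst h
    refine Eq.trans ?_ (hw j)
    rw [← sum_mul_omegaMat hω]
    by_cases h2 : b = 2 <;> simp [h2, mul_add, Finset.sum_add_distrib, mul_comm]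
  · simp [h]

lemma vecMul_configMatY {n : ℕ} {G : SimpleGraph (Fin n)} {p : Fin n → Fin 3 → ℝ}
    {ω : Fin n → Fin n → ℝ} {lam : Fin n → ℝ} (hω : IsStress G ω)
    (hequil : IsEquilStressY p ω lam) (a : Fin 6) :
    Matrix.vecMul (configMatY p a) (stressMatY ω lam) = 0 := by
  have h0 := fun j => hequil j 0
  have h1 := fun j => hequil j 1
  have h2 := fun j => hequil j 2
  fin_cases a
  · exact vecMul_stressMatY_block hω 0 (fun i => p i 0) h0
  · exact vecMul_stressMatY_block hω 1 (fun i => p i 1) h1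
  · exact vecMul_stressMatY_block hω 2 (fun i => p i 2) h2
  · exact vecMul_stressMatY_block hω 0 (fun i => p i 1) h1
  · exact vecMul_stressMatY_block hω 1 (fun i => p i 0) h0
  · exact vecMul_stressMatY_block hω 2 (fun _ => 1) (by simp)

/-- Rank-nullity for the left kernel of a matrix. -/
lemma Matrix.rank_add_finrank_ker_vecMulLinear {m n K : Type*} [Fintype m] [Fintype n] [Field K]
    (A : Matrix m n K) :
    A.rank + Module.finrank K (LinearMap.ker A.vecMulLinear) = Fintype.card m := by
  have h := LinearMap.finrank_range_add_finrank_ker A.vecMulLinear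
  rwa [range_vecMulLinear, ← Matrix.rank_eq_finrank_span_row,
    Module.finrank_fintype_fun_eq_card] at h

theorem stmt1 (n : ℕ) (G : SimpleGraph (Fin n))
    (r : Fin n → ℝ) (hr : ∀ i, 0 < r i)
    (p : Fin n → Fin 3 → ℝ) (hp : ∀ i, (p i 0) ^ 2 + (p i 1) ^ 2 = r i)
    (ω : Fin n → Fin n → ℝ) (lam : Fin n → ℝ) (hω : IsStress G ω)
    (hequil : IsEquilStressY p ω lam) :
    configMatY p * stressMatY ω lam = 0 ∧
    (∀ a : Fin 6, Matrix.vecMul (configMatY p a) (stressMatY ω lam) = 0) ∧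
    (stressMatY ω lam).rank ≤ 3 * n - (configMatY p).rank ∧
    ((stressMatY ω lam).rank = 3 * n - (configMatY p).rank →
      Submodule.span ℝ (Set.range (fun a : Fin 6 => configMatY p a)) =
        LinearMap.ker (stressMatY ω lam).vecMulLinear) := by
  have hrow := vecMul_configMatY hω hequil
  have hle : Submodule.span ℝ (Set.range (fun a : Fin 6 => configMatY p a)) ≤
      LinearMap.ker (stressMatY ω lam).vecMulLinear := by
    rw [Submodule.span_le]
    rintro _ ⟨a, rfl⟩
    exact hrow a
  have hspan : (configMatY p).rank =
      Module.finrank ℝ (Submodule.span ℝ (Set.range (fun a : Fin 6 => configMatY p a))) :=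
    (configMatY p).rank_eq_finrank_span_row
  have hnull := (stressMatY ω lam).rank_add_finrank_ker_vecMulLinear
  have hfin := Submodule.finrank_mono hle
  rw [Fintype.card_prod, Fintype.card_fin, Fintype.card_fin] at hnull
  refine ⟨?_, hrow, by omega, fun heq => Submodule.eq_of_le_of_finrank_eq hle (by omega)⟩
  ext a c
  exact congrFun (hrow a) c
end

section
/- Let (G,p) and (G,q) be frameworks on a family of concentric cylinders Y and let (ω,λ) be an equilibrium stress for both (G,p) and (G,q) on Y. Suppose rank Ω_Y(ω,λ) = 3n − rank C_Y(G,p). Then there exist fixed reals a,b,c,d,e,f such that q(v_i) = M p(v_i) + (0,0,f) for all 1 ≤ i ≤ n, where M is the 3×3 matrix with rows (a,b,0), (c,d,0), (0,0,e). -/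
open Finset

lemma stressMatY_mulVec_apply {n : ℕ} (ω : Fin n → Fin n → ℝ) (lam : Fin n → ℝ)
    (hdiag : ∀ i, ω i i = 0) (v : Fin 3 × Fin n → ℝ) (a : Fin 3) (i : Fin n) :
    (stressMatY ω lam).mulVec v (a, i) =
      (∑ j, ω i j * (v (a, i) - v (a, j))) + lam i * (if a = 2 then 0 else v (a, i)) := by
  have hentry (j : Fin n) : stressMatY ω lam (a, i) (a, j) * v (a, j) =
      (if i = j then (∑ k, ω i k) * v (a, i) + lam i * (if a = 2 then 0 else v (a, i)) else 0)
        - ω i j * v (a, j) := by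
    by_cases hij : i = j
    · subst hij
      by_cases ha : a = 2 <;> simp [stressMatY, omegaMat, hdiag, ha, add_mul]
    · simp [stressMatY, omegaMat, hij]
  have hblock : (stressMatY ω lam).mulVec v (a, i) =
      ∑ j, stressMatY ω lam (a, i) (a, j) * v (a, j) := by
    rw [Matrix.mulVec, dotProduct, Fintype.sum_prod_type, Finset.sum_eq_single a]
    · intro b _ hb
      simp [stressMatY, hb.symm]
    · simp
  simp only [hblock, hentry, Finset.sum_sub_distrib, mul_sub, Finset.sum_ite_eq,
    Finset.mem_univ, if_true, Finset.sum_mul]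
  ring

lemma stressMatY_mulVec_eq_zero_iff {n : ℕ} (ω : Fin n → Fin n → ℝ) (lam : Fin n → ℝ)
    (hdiag : ∀ i, ω i i = 0) (v : Fin 3 × Fin n → ℝ) :
    (stressMatY ω lam).mulVec v = 0 ↔ IsEquilStressY (fun i a => v (a, i)) ω lam := by
  rw [funext_iff, Prod.forall, forall_comm]
  simp only [stressMatY_mulVec_apply ω lam hdiag, Pi.zero_apply, IsEquilStressY]

lemma stressMatY_mulVec_configMatY_row {n : ℕ} {p : Fin n → Fin 3 → ℝ}
    {ω : Fin n → Fin n → ℝ} {lam : Fin n → ℝ} (hdiag : ∀ i, ω i i = 0)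
    (hp : IsEquilStressY p ω lam) (k : Fin 6) :
    (stressMatY ω lam).mulVec ((configMatY p).row k) = 0 := by
  rw [stressMatY_mulVec_eq_zero_iff ω lam hdiag]
  intro i a
  have h0 := hp i 0
  have h1 := hp i 1
  have h2 := hp i 2
  fin_cases k <;> fin_cases a <;> simp_all [configMatY, Matrix.row]

lemma ker_stressMatY_eq_span_row {n : ℕ} {p : Fin n → Fin 3 → ℝ}
    {ω : Fin n → Fin n → ℝ} {lam : Fin n → ℝ} (hdiag : ∀ i, ω i i = 0)
    (hp : IsEquilStressY p ω lam)
    (hrank : (stressMatY ω lam).rank = 3 * n - (configMatY p).rank) :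
    Submodule.span ℝ (Set.range (configMatY p).row) =
      LinearMap.ker (stressMatY ω lam).mulVecLin := by
  apply Submodule.eq_of_le_of_finrank_eq
  · rw [Submodule.span_le]
    rintro _ ⟨k, rfl⟩
    exact stressMatY_mulVec_configMatY_row hdiag hp k
  · rw [← Matrix.rank_eq_finrank_span_row]
    have hnull := LinearMap.finrank_range_add_finrank_ker (stressMatY ω lam).mulVecLin
    have hle := (configMatY p).rank_le_card_width
    simp only [Module.finrank_fintype_fun_eq_card, Fintype.card_prod, Fintype.card_fin]
      at hnull hle
    rw [Matrix.rank] at hrank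
    omega

theorem stmt3 (n : ℕ) (G : SimpleGraph (Fin n))
    (r : Fin n → ℝ) (hr : ∀ i, 0 < r i)
    (p q : Fin n → Fin 3 → ℝ)
    (hp : ∀ i, (p i 0) ^ 2 + (p i 1) ^ 2 = r i)
    (hq : ∀ i, (q i 0) ^ 2 + (q i 1) ^ 2 = r i)
    (ω : Fin n → Fin n → ℝ) (lam : Fin n → ℝ) (hω : IsStress G ω)
    (hequilp : IsEquilStressY p ω lam) (hequilq : IsEquilStressY q ω lam)
    (hrank : (stressMatY ω lam).rank = 3 * n - (configMatY p).rank) :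
    ∃ a b c d e f : ℝ, ∀ i,
      q i 0 = a * p i 0 + b * p i 1 ∧
      q i 1 = c * p i 0 + d * p i 1 ∧
      q i 2 = e * p i 2 + f := by
  have hdiag (i : Fin n) : ω i i = 0 := hω.2 i i (G.irrefl)
  have hmem : (fun c : Fin 3 × Fin n => q c.2 c.1) ∈
      Submodule.span ℝ (Set.range (configMatY p).row) := by
    rw [ker_stressMatY_eq_span_row hdiag hequilp hrank]
    exact (stressMatY_mulVec_eq_zero_iff ω lam hdiag _).2 hequilq
  obtain ⟨t, ht⟩ := (Submodule.mem_span_range_iff_exists_fun ℝ).1 hmem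
  refine ⟨t 0, t 3, t 4, t 1, t 2, t 5, fun i => ?_⟩
  have h0 := congrFun ht (0, i)
  have h1 := congrFun ht (1, i)
  have h2 := congrFun ht (2, i)
  simp [configMatY, Matrix.row, Fin.sum_univ_six] at h0 h1 h2
  exact ⟨by linarith, by linarith, by linarith⟩
end

section
/- Let (G,p) and (G,q) be frameworks on a family of concentric ellipsoids E and let (ω,λ) be an equilibrium stress for both (G,p) and (G,q) on E. Suppose rank Ω_E(ω,λ) = 3n − rank C_E(G,p). Then there exist fixed reals a,d,e such that q(v_i) = diag(a,d,e) · p(v_i) for all 1 ≤ i ≤ n. -/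
open Finset

/-- The coefficients `(1, α, β)` of the quadratic form defining the ellipsoids. -/
def ellCoeff (α β : ℚ) (a : Fin 3) : ℝ :=
  if a = 0 then 1 else if a = 1 then (α : ℝ) else (β : ℝ)

/-- The `3n×3n` stress matrix `Ω_E(ω,λ) = diag(Ω+Λ, Ω+αΛ, Ω+βΛ)` on a family of concentric
ellipsoids, indexed by `Fin 3 × Fin n` (coordinate block × vertex). -/
def stressMatE {n : ℕ} (α β : ℚ) (ω : Fin n → Fin n → ℝ) (lam : Fin n → ℝ) :
    Matrix (Fin 3 × Fin n) (Fin 3 × Fin n) ℝ :=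
  fun r c => if r.1 = c.1 then
      omegaMat ω r.2 c.2 + (if r.2 = c.2 then ellCoeff α β r.1 * lam r.2 else 0)
    else 0

/-- `(ω,λ)` is an equilibrium stress for `(G,p)` on the family of concentric ellipsoids:
`∑_j ω_ij (p_i − p_j) + λ_i (x_i, α y_i, β z_i) = 0` for all `i`. -/
def IsEquilStressE {n : ℕ} (α β : ℚ) (p : Fin n → Fin 3 → ℝ)
    (ω : Fin n → Fin n → ℝ) (lam : Fin n → ℝ) : Prop :=
  ∀ i, ∀ a : Fin 3,
    (∑ j, ω i j * (p i a - p j a)) + lam i * (ellCoeff α β a * p i a) = 0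

/-- The `3 × 3n` configuration matrix `C_E(G,p)`, with rows `(x|0|0), (0|y|0), (0|0|z)`. -/
def configMatE {n : ℕ} (p : Fin n → Fin 3 → ℝ) : Matrix (Fin 3) (Fin 3 × Fin n) ℝ :=
  fun a c => if c.1 = a then p c.2 a else 0

open Matrix in
/-- An equilibrium stress annihilates the coordinates of its framework. -/
lemma IsEquilStressE.stressMatE_mulVec_eq_zero {n : ℕ} {α β : ℚ} {p : Fin n → Fin 3 → ℝ}
    {ω : Fin n → Fin n → ℝ} {lam : Fin n → ℝ} (h : IsEquilStressE α β p ω lam)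
    (hdiag : ∀ i, ω i i = 0) :
    stressMatE α β ω lam *ᵥ (fun c => p c.2 c.1) = 0 := by
  funext ⟨a, i⟩
  have hentry : ∀ j, omegaMat ω i j * p j a
      = (if i = j then (∑ k, ω i k) * p i a else 0) - ω i j * p j a := by
    intro j
    by_cases hij : i = j
    · subst hij
      simp [omegaMat, hdiag]
    · simp [omegaMat, hij]
  have hi := h i a
  simp only [mul_sub, Finset.sum_sub_distrib, ← Finset.sum_mul] at hi
  simp only [mulVec, dotProduct, stressMatE, Fintype.sum_prod_type, Pi.zero_apply, ite_mul,
    zero_mul, Finset.sum_ite_irrel, Finset.sum_const_zero, Finset.sum_ite_eq, Finset.mem_univ,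
    if_true, add_mul, Finset.sum_add_distrib, hentry, Finset.sum_sub_distrib]
  linarith

/-- Equilibrium is preserved by scaling the coordinates independently. -/
lemma IsEquilStressE.smul_coords {n : ℕ} {α β : ℚ} {p : Fin n → Fin 3 → ℝ}
    {ω : Fin n → Fin n → ℝ} {lam : Fin n → ℝ} (h : IsEquilStressE α β p ω lam)
    (s : Fin 3 → ℝ) : IsEquilStressE α β (fun i a => s a * p i a) ω lam := by
  intro i a
  have hi := congrArg (s a * ·) (h i a)
  simp only [mul_add, Finset.mul_sum, mul_zero] at hi
  rw [← hi]
  congr 1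
  · exact Finset.sum_congr rfl fun j _ => by ring
  · ring

open Matrix in
/-- The combination of the rows of the configuration matrix with coefficients `s` consists of
the coordinates of the framework scaled by `s`. -/
lemma configMatE_transpose_mulVec {n : ℕ} (p : Fin n → Fin 3 → ℝ) (s : Fin 3 → ℝ) :
    (configMatE p)ᵀ *ᵥ s = fun c => s c.1 * p c.2 c.1 := by
  funext c
  simp [mulVec, dotProduct, configMatE, mul_comm]

theorem stmt4 (n : ℕ) (G : SimpleGraph (Fin n)) (α β : ℚ) (hα : 1 < α) (hβ : α < β)
    (r : Fin n → ℝ) (hr : ∀ i, 0 < r i)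
    (p q : Fin n → Fin 3 → ℝ)
    (hp : ∀ i, (p i 0) ^ 2 + (α : ℝ) * (p i 1) ^ 2 + (β : ℝ) * (p i 2) ^ 2 = r i)
    (hq : ∀ i, (q i 0) ^ 2 + (α : ℝ) * (q i 1) ^ 2 + (β : ℝ) * (q i 2) ^ 2 = r i)
    (ω : Fin n → Fin n → ℝ) (lam : Fin n → ℝ) (hω : IsStress G ω)
    (hequilp : IsEquilStressE α β p ω lam) (hequilq : IsEquilStressE α β q ω lam)
    (hrank : (stressMatE α β ω lam).rank = 3 * n - (configMatE p).rank) :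
    ∃ a d e : ℝ, ∀ i,
      q i 0 = a * p i 0 ∧ q i 1 = d * p i 1 ∧ q i 2 = e * p i 2 := by
  have hdiag : ∀ i, ω i i = 0 := fun i => hω.2 i i (G.irrefl)
  have hle : LinearMap.range (configMatE p).transpose.mulVecLin ≤
      LinearMap.ker (stressMatE α β ω lam).mulVecLin := by
    rintro _ ⟨s, rfl⟩
    rw [LinearMap.mem_ker, Matrix.mulVecLin_apply, Matrix.mulVecLin_apply,
      configMatE_transpose_mulVec]
    exact (hequilp.smul_coords s).stressMatE_mulVec_eq_zero hdiag
  have heq := Submodule.eq_of_le_of_finrank_le hle (by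
    have hnull := (stressMatE α β ω lam).mulVecLin.finrank_range_add_finrank_ker
    have hC := (configMatE p).rank_le_card_width
    have hT : Module.finrank ℝ (LinearMap.range (configMatE p).transpose.mulVecLin) =
        (configMatE p).rank := Matrix.rank_transpose _
    change (stressMatE α β ω lam).rank + _ = _ at hnull
    simp only [Module.finrank_fintype_fun_eq_card, Fintype.card_prod, Fintype.card_fin]
      at hnull hC
    omega)
  have hmem : (fun c : Fin 3 × Fin n => q c.2 c.1) ∈
      LinearMap.ker (stressMatE α β ω lam).mulVecLin :=
    hequilq.stressMatE_mulVec_eq_zero hdiag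
  rw [← heq] at hmem
  obtain ⟨s, hs⟩ := hmem
  rw [Matrix.mulVecLin_apply, configMatE_transpose_mulVec] at hs
  have hs' : ∀ i a, q i a = s a * p i a := fun i a => (congrFun hs (a, i)).symm
  exact ⟨s 0, s 1, s 2, fun i => ⟨hs' i 0, hs' i 1, hs' i 2⟩⟩
end

section
/- Let (G,p) and (G,q) be frameworks on a family of concentric cylinders Y such that (G,q) is a Y-affine image of (G,p), i.e. there exist reals a,b,c,d,e,f with q(v_i) = M p(v_i) + (0,0,f) for all i, where M is the 3×3 matrix with rows (a,b,0), (c,d,0), (0,0,e). Then every equilibrium stress (ω,λ) for (G,p) on Y is also an equilibrium stress for (G,q) on Y. -/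
open Finset

theorem stmt5 (n : ℕ) (G : SimpleGraph (Fin n))
    (r : Fin n → ℝ) (hr : ∀ i, 0 < r i)
    (p q : Fin n → Fin 3 → ℝ)
    (hp : ∀ i, (p i 0) ^ 2 + (p i 1) ^ 2 = r i)
    (hq : ∀ i, (q i 0) ^ 2 + (q i 1) ^ 2 = r i)
    (a b c d e f : ℝ)
    (haff : ∀ i, q i 0 = a * p i 0 + b * p i 1 ∧
                 q i 1 = c * p i 0 + d * p i 1 ∧
                 q i 2 = e * p i 2 + f)
    (ω : Fin n → Fin n → ℝ) (lam : Fin n → ℝ) (hω : IsStress G ω)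
    (hequilp : IsEquilStressY p ω lam) :
    IsEquilStressY q ω lam := by
  have h0 := fun i => hequilp i 0
  have h1 := fun i => hequilp i 1
  have h2 := fun i => hequilp i 2
  simp only [Fin.reduceEq, if_false, if_true] at h0 h1 h2
  intro i k
  fin_cases k
  · have hsum : ∑ j, ω i j * (q i 0 - q j 0) =
        a * ∑ j, ω i j * (p i 0 - p j 0) + b * ∑ j, ω i j * (p i 1 - p j 1) := by
      simp only [(haff _).1, mul_sum, ← sum_add_distrib]
      exact sum_congr rfl fun j _ => by ring
    simp only [Fin.zero_eta, Fin.reduceEq, if_false]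
    rw [hsum, (haff i).1]
    linear_combination a * h0 i + b * h1 i
  · have hsum : ∑ j, ω i j * (q i 1 - q j 1) =
        c * ∑ j, ω i j * (p i 0 - p j 0) + d * ∑ j, ω i j * (p i 1 - p j 1) := by
      simp only [(haff _).2.1, mul_sum, ← sum_add_distrib]
      exact sum_congr rfl fun j _ => by ring
    simp only [Fin.mk_one, Fin.reduceEq, if_false]
    rw [hsum, (haff i).2.1]
    linear_combination c * h0 i + d * h1 i
  · have hsum : ∑ j, ω i j * (q i 2 - q j 2) = e * ∑ j, ω i j * (p i 2 - p j 2) := by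
      simp only [(haff _).2.2, mul_sum]
      exact sum_congr rfl fun j _ => by ring
    simp only [Fin.reduceFinMk, if_true, hsum]
    linear_combination e * h2 i
end

section
/- Let (G,p) be a framework which is fully realised on a family of concentric cylinders Y (i.e. rank C_Y(G,p) = 6), and let (ω,λ) be an equilibrium stress for (G,p) on Y such that Ω_Y(ω,λ) is positive semi-definite and rank Ω_Y(ω,λ) = 3n − 6. Let (G,q) be a framework on Y which is equivalent to (G,p). Then (ω,λ) is an equilibrium stress for (G,q) on Y, and there exist reals a,b,c,d,e,f with q(v_i) = M p(v_i) + (0,0,f) for all i, where M is the 3×3 matrix with rows (a,b,0), (c,d,0), (0,0,e). -/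
open Finset

/-- For a loopless `ω`, the stress matrix acts on a configuration as the equilibrium operator. -/
lemma stressMatY_mulVec {n : ℕ} {ω : Fin n → Fin n → ℝ} (hdiag : ∀ i, ω i i = 0)
    (lam : Fin n → ℝ) (v : Fin 3 × Fin n → ℝ) (a : Fin 3) (i : Fin n) :
    (stressMatY ω lam).mulVec v (a, i) =
      (∑ j, ω i j * (v (a, i) - v (a, j))) + lam i * (if a = 2 then 0 else v (a, i)) := by
  have hentry : ∀ j, (omegaMat ω i j + (if i = j ∧ a ≠ 2 then lam i else 0)) * v (a, j) =
      (if i = j then (∑ k, ω i k) * v (a, i) + lam i * (if a = 2 then 0 else v (a, i)) else 0)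
        - ω i j * v (a, j) := by
    intro j
    by_cases hij : i = j
    · subst hij
      by_cases ha : a = 2 <;> simp [omegaMat, ha, hdiag, add_mul]
    · simp [omegaMat, hij]
  have hblock : (stressMatY ω lam).mulVec v (a, i) =
      ∑ j, (omegaMat ω i j + (if i = j ∧ a ≠ 2 then lam i else 0)) * v (a, j) := by
    simp only [Matrix.mulVec, dotProduct, stressMatY, Fintype.sum_prod_type]
    rw [Finset.sum_eq_single a]
    · simp
    · intro b _ hb
      simp [hb.symm]
    · simp
  rw [hblock, Finset.sum_congr rfl fun j _ => hentry j]
  simp only [Finset.sum_sub_distrib, mul_sub, Finset.sum_ite_eq, Finset.mem_univ, if_true,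
    Finset.sum_mul]
  ring

/-- Summation by parts: the energy of a symmetric stress as a sum of squared differences. -/
lemma two_mul_sum_mul_sum_sub {n : ℕ} {ω : Fin n → Fin n → ℝ} (hsymm : ∀ i j, ω i j = ω j i)
    (u : Fin n → ℝ) :
    2 * ∑ i, u i * ∑ j, ω i j * (u i - u j) = ∑ i, ∑ j, ω i j * (u i - u j) ^ 2 := by
  have hswap : ∑ i, u i * ∑ j, ω i j * (u i - u j) =
      ∑ i, ∑ j, u j * (ω i j * (u j - u i)) := by
    simp only [Finset.mul_sum]
    rw [Finset.sum_comm]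
    exact Finset.sum_congr rfl fun i _ => Finset.sum_congr rfl fun j _ => by rw [hsymm]
  rw [two_mul]
  nth_rewrite 2 [hswap]
  simp only [Finset.mul_sum, ← Finset.sum_add_distrib]
  exact Finset.sum_congr rfl fun i _ => Finset.sum_congr rfl fun j _ => by ring

/-- The quadratic form of the stress matrix in terms of edge lengths and distances to the axis. -/
lemma two_mul_dotProduct_stressMatY {n : ℕ} {ω : Fin n → Fin n → ℝ}
    (hsymm : ∀ i j, ω i j = ω j i) (hdiag : ∀ i, ω i i = 0) (lam : Fin n → ℝ)
    (s : Fin n → Fin 3 → ℝ) :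
    2 * ((fun c : Fin 3 × Fin n => s c.2 c.1) ⬝ᵥ
        (stressMatY ω lam).mulVec fun c => s c.2 c.1) =
      (∑ i, ∑ j, ω i j * ∑ a, (s i a - s j a) ^ 2) +
        2 * ∑ i, lam i * (s i 0 ^ 2 + s i 1 ^ 2) := by
  have hlam : ∑ i, lam i * (s i 0 ^ 2 + s i 1 ^ 2) =
      ∑ i, s i 0 * (lam i * s i 0) + ∑ i, s i 1 * (lam i * s i 1) := by
    rw [← Finset.sum_add_distrib]
    exact Finset.sum_congr rfl fun i _ => by ring
  have h := fun a => two_mul_sum_mul_sum_sub hsymm fun i => s i a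
  simp only [dotProduct, Fintype.sum_prod_type, stressMatY_mulVec hdiag, Fin.sum_univ_three,
    mul_add, Finset.sum_add_distrib] at *
  rw [← h 0, ← h 1, ← h 2]
  simp
  linarith

/-- The rows of the configuration matrix of a framework in equilibrium are in the kernel of the
stress matrix. -/
lemma span_row_configMatY_le_ker {n : ℕ} {p : Fin n → Fin 3 → ℝ} {ω : Fin n → Fin n → ℝ}
    {lam : Fin n → ℝ} (hdiag : ∀ i, ω i i = 0) (hp : IsEquilStressY p ω lam) :
    Submodule.span ℝ (Set.range (configMatY p).row) ≤
      LinearMap.ker (stressMatY ω lam).mulVecLin := by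
  rw [Submodule.span_le]
  rintro _ ⟨k, rfl⟩
  rw [SetLike.mem_coe, LinearMap.mem_ker, Matrix.mulVecLin_apply]
  ext ⟨a, i⟩
  rw [stressMatY_mulVec hdiag]
  have h0 := hp i 0
  have h1 := hp i 1
  have h2 := hp i 2
  fin_cases k <;> fin_cases a <;> simp_all [configMatY, Matrix.row]

/-- If the configuration and stress matrices have maximal ranks, the rows of the former span the
kernel of the latter. -/
lemma span_row_configMatY_eq_ker {n : ℕ} {p : Fin n → Fin 3 → ℝ} {ω : Fin n → Fin n → ℝ}
    {lam : Fin n → ℝ} (hdiag : ∀ i, ω i i = 0) (hp : IsEquilStressY p ω lam)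
    (hfull : (configMatY p).rank = 6) (hrank : (stressMatY ω lam).rank = 3 * n - 6) :
    Submodule.span ℝ (Set.range (configMatY p).row) =
      LinearMap.ker (stressMatY ω lam).mulVecLin := by
  refine Submodule.eq_of_le_of_finrank_eq (span_row_configMatY_le_ker hdiag hp) ?_
  rw [← Matrix.rank_eq_finrank_span_row, hfull]
  have hwidth := Matrix.rank_le_card_width (configMatY p)
  have hnull := (stressMatY ω lam).mulVecLin.finrank_range_add_finrank_ker
  change (stressMatY ω lam).rank + _ = _ at hnull
  simp only [Module.finrank_fintype_fun_eq_card, Fintype.card_prod, Fintype.card_fin] at *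
  omega

theorem stmt7 (n : ℕ) (G : SimpleGraph (Fin n))
    (r : Fin n → ℝ) (hr : ∀ i, 0 < r i)
    (p q : Fin n → Fin 3 → ℝ)
    (hp : ∀ i, (p i 0) ^ 2 + (p i 1) ^ 2 = r i)
    (hq : ∀ i, (q i 0) ^ 2 + (q i 1) ^ 2 = r i)
    (hfull : (configMatY p).rank = 6)
    (ω : Fin n → Fin n → ℝ) (lam : Fin n → ℝ) (hω : IsStress G ω)
    (hequilp : IsEquilStressY p ω lam)
    (hpsd : (stressMatY ω lam).PosSemidef)
    (hrank : (stressMatY ω lam).rank = 3 * n - 6)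
    (hequiv : ∀ i j, G.Adj i j →
      ∑ a, (p i a - p j a) ^ 2 = ∑ a, (q i a - q j a) ^ 2) :
    IsEquilStressY q ω lam ∧
    ∃ a b c d e f : ℝ, ∀ i,
      q i 0 = a * p i 0 + b * p i 1 ∧
      q i 1 = c * p i 0 + d * p i 1 ∧
      q i 2 = e * p i 2 + f := by
  have hdiag : ∀ i, ω i i = 0 := fun i => hω.2 i i (G.irrefl)
  have henergy : (∑ i, ∑ j, ω i j * ∑ a, (q i a - q j a) ^ 2) =
      ∑ i, ∑ j, ω i j * ∑ a, (p i a - p j a) ^ 2 := by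
    refine Finset.sum_congr rfl fun i _ => Finset.sum_congr rfl fun j _ => ?_
    by_cases hij : G.Adj i j
    · rw [hequiv i j hij]
    · simp [hω.2 i j hij]
  have hpker : (stressMatY ω lam).mulVec (fun c => p c.2 c.1) = 0 := by
    ext ⟨a, i⟩
    rw [stressMatY_mulVec hdiag]
    exact hequilp i a
  have hqker : (stressMatY ω lam).mulVec (fun c => q c.2 c.1) = 0 := by
    have hP := two_mul_dotProduct_stressMatY hω.1 hdiag lam p
    have hQ := two_mul_dotProduct_stressMatY hω.1 hdiag lam q
    rw [hpker, dotProduct_zero] at hP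
    simp only [hp] at hP
    simp only [hq, henergy] at hQ
    refine (hpsd.dotProduct_mulVec_zero_iff _).1 ?_
    rw [star_trivial]
    linarith
  refine ⟨fun i a => ?_, ?_⟩
  · rw [← stressMatY_mulVec hdiag lam (fun c => q c.2 c.1) a i, hqker, Pi.zero_apply]
  · have hmem : (fun c : Fin 3 × Fin n => q c.2 c.1) ∈
        Submodule.span ℝ (Set.range (configMatY p).row) := by
      rw [span_row_configMatY_eq_ker hdiag hequilp hfull hrank]
      exact hqker
    obtain ⟨t, ht⟩ := (Submodule.mem_span_range_iff_exists_fun ℝ).1 hmem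
    refine ⟨t 0, t 3, t 4, t 1, t 2, t 5, fun i => ?_⟩
    have h := fun a => congrFun ht (a, i)
    have h0 := h 0
    have h1 := h 1
    have h2 := h 2
    simp [Fin.sum_univ_six, configMatY, Matrix.row] at h0 h1 h2
    refine ⟨?_, ?_, ?_⟩ <;> linarith
end

section
/- Let (G,p) be a generic framework on a family of concentric ellipsoids E with n ≥ 5 vertices. Suppose (G,q) is a framework on E which is equivalent to (G,p) and which is an E-affine image of (G,p), i.e. there exist reals a,d,e with q(v_i) = diag(a,d,e) · p(v_i) for all i. Then (G,q) is congruent to (G,p). -/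
open Finset

/-- The configuration `p` is generic on the family of concentric ellipsoids with
parameters `r`: the transcendence degree of `ℚ(r,p)` over `ℚ(r)` equals `2n`, expressed
by the existence of a transcendence basis of size `2n` among the coordinates of `p`. -/
def IsGenericConf (n : ℕ) (r : Fin n → ℝ) (p : Fin n → Fin 3 → ℝ) : Prop :=
  ∃ T : Finset ℝ,
    (↑T : Set ℝ) ⊆ Set.range (fun c : Fin n × Fin 3 => p c.1 c.2) ∧
    T.card = 2 * n ∧
    AlgebraicIndependent (IntermediateField.adjoin ℚ (Set.range r)) ((↑) : T → ℝ) ∧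
    ∀ (i : Fin n) (a : Fin 3), IsAlgebraic
      (IntermediateField.adjoin (IntermediateField.adjoin ℚ (Set.range r)) (↑T : Set ℝ))
      (p i a)

/-- A family of at most `#T` elements over which an algebraically independent finite set `T` is
algebraic is itself algebraically independent. -/
theorem algebraicIndependent_of_isAlgebraic_adjoin_range {K L ι : Type*} [Field K] [Field L]
    [Algebra K L] [Fintype ι] (f : ι → L) (T : Finset L)
    (hT : AlgebraicIndependent K ((↑) : T → L)) (hcard : Fintype.card ι ≤ T.card)
    (halg : ∀ t ∈ T, IsAlgebraic (Algebra.adjoin K (Set.range f)) t) :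
    AlgebraicIndependent K f := by
  classical
  set M := AlgebraicIndependent.matroid K L
  have hTi : M.Indep (T : Set L) := hT
  have hsub : (T : Set L) ⊆ M.closure (Set.range f) := by
    intro t ht
    rw [AlgebraicIndependent.matroid_closure_eq]
    exact halg t ht
  obtain ⟨B, hB⟩ := M.exists_isBasis (Set.range f) (Set.subset_univ _)
  have hTB : (T.card : ℕ∞) ≤ B.encard := by
    rw [← Set.encard_coe_eq_coe_finsetCard, ← hTi.eRk_eq_encard, hB.encard_eq_eRk,
      ← M.eRk_closure_eq (Set.range f)]
    exact M.eRk_mono hsub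
  have hrange : (Set.range f).encard = ((univ.image f).card : ℕ∞) := by
    rw [← Set.encard_coe_eq_coe_finsetCard]
    simp
  have hle : (univ.image f).card ≤ Fintype.card ι := card_image_le
  have hBeq : B = Set.range f := by
    refine ((Set.finite_range f).subset hB.subset).eq_of_subset_of_encard_le hB.subset ?_
    rw [hrange]
    exact le_trans (by exact_mod_cast hle.trans hcard) hTB
  have hinj : Function.Injective f := by
    rw [← Set.injOn_univ, ← coe_univ, ← card_image_iff]
    refine le_antisymm card_image_le ?_
    have : (T.card : ℕ∞) ≤ ((univ.image f).card : ℕ∞) := by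
      rw [← hrange, ← hBeq]
      exact hTB
    rw [card_univ]
    exact hcard.trans (by exact_mod_cast this)
  have hind : M.Indep (Set.range f) := hBeq ▸ hB.indep
  exact (algebraicIndependent_subtype_range hinj).mp hind

/-- In a generic configuration on concentric ellipsoids, the second and third coordinates of the
points are algebraically independent over the field generated by the parameters. -/
theorem IsGenericConf.algebraicIndependent {n : ℕ} {r : Fin n → ℝ} {p : Fin n → Fin 3 → ℝ}
    (hgen : IsGenericConf n r p) (α β : ℚ)
    (hp : ∀ i, (p i 0) ^ 2 + (α : ℝ) * (p i 1) ^ 2 + (β : ℝ) * (p i 2) ^ 2 = r i) :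
    AlgebraicIndependent (IntermediateField.adjoin ℚ (Set.range r))
      (fun c : Fin n × Fin 2 => p c.1 c.2.succ) := by
  obtain ⟨T, hTsub, hTcard, hT, -⟩ := hgen
  refine algebraicIndependent_of_isAlgebraic_adjoin_range _ T hT
    (by simp [hTcard, mul_comm]) fun t ht => ?_
  obtain ⟨⟨i, a⟩, rfl⟩ := hTsub ht
  set K := IntermediateField.adjoin ℚ (Set.range r)
  set S := Algebra.adjoin K (Set.range fun c : Fin n × Fin 2 => p c.1 c.2.succ)
  have hmem : ∀ b : Fin 2, p i b.succ ∈ S := fun b => Algebra.subset_adjoin ⟨(i, b), rfl⟩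
  refine IsIntegral.isAlgebraic ?_
  induction a using Fin.cases with
  | zero =>
    refine IsIntegral.of_pow (n := 2) two_pos ?_
    have hr : r i ∈ S :=
      S.algebraMap_mem (⟨r i, IntermediateField.subset_adjoin _ _ ⟨i, rfl⟩⟩ : K)
    have hrat : ∀ c : ℚ, (c : ℝ) ∈ S := fun c => by
      simpa using S.algebraMap_mem (c : K)
    have h0 : p i 0 ^ 2 ∈ S := by
      have : p i 0 ^ 2 = r i - α * p i 1 ^ 2 - β * p i 2 ^ 2 := by
        rw [← hp i]
        ring
      rw [this]
      exact S.sub_mem (S.sub_mem hr (S.mul_mem (hrat α) (S.pow_mem (hmem 0) 2)))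
        (S.mul_mem (hrat β) (S.pow_mem (hmem 1) 2))
    exact isIntegral_algebraMap (R := S) (x := ⟨_, h0⟩)
  | succ b => exact isIntegral_algebraMap (R := S) (x := ⟨_, hmem b⟩)

/-- The rows `(r i, y i ^ 2, z i ^ 2)` of three points of a generic configuration are linearly
independent. -/
theorem IsGenericConf.det_ne_zero {n : ℕ} {r : Fin n → ℝ} {p : Fin n → Fin 3 → ℝ}
    (hgen : IsGenericConf n r p) (α β : ℚ)
    (hp : ∀ i, (p i 0) ^ 2 + (α : ℝ) * (p i 1) ^ 2 + (β : ℝ) * (p i 2) ^ 2 = r i)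
    {i j k : Fin n} (hij : i ≠ j) (hik : i ≠ k) (hjk : j ≠ k) (hri : r i ≠ 0) :
    r i * (p j 1 ^ 2 * p k 2 ^ 2 - p k 1 ^ 2 * p j 2 ^ 2)
      - r j * (p i 1 ^ 2 * p k 2 ^ 2 - p k 1 ^ 2 * p i 2 ^ 2)
      + r k * (p i 1 ^ 2 * p j 2 ^ 2 - p j 1 ^ 2 * p i 2 ^ 2) ≠ 0 := by
  intro h
  have hind := hgen.algebraicIndependent α β hp
  set K := IntermediateField.adjoin ℚ (Set.range r)
  let ρ : Fin n → K := fun l => ⟨r l, IntermediateField.subset_adjoin _ _ ⟨l, rfl⟩⟩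
  let Y : Fin n → MvPolynomial (Fin n × Fin 2) K := fun l => MvPolynomial.X (l, 0)
  let Z : Fin n → MvPolynomial (Fin n × Fin 2) K := fun l => MvPolynomial.X (l, 1)
  let P : MvPolynomial (Fin n × Fin 2) K :=
    MvPolynomial.C (ρ i) * (Y j ^ 2 * Z k ^ 2 - Y k ^ 2 * Z j ^ 2)
      - MvPolynomial.C (ρ j) * (Y i ^ 2 * Z k ^ 2 - Y k ^ 2 * Z i ^ 2)
      + MvPolynomial.C (ρ k) * (Y i ^ 2 * Z j ^ 2 - Y j ^ 2 * Z i ^ 2)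
  have hP : P = 0 := by
    refine (algebraicIndependent_iff.mp hind) P ?_
    simpa [P, Y, Z, ρ, MvPolynomial.aeval_C, IntermediateField.algebraMap_apply] using h
  have hev := congrArg (MvPolynomial.eval fun c : Fin n × Fin 2 =>
    if c = (j, 0) ∨ c = (k, 1) then (1 : K) else 0) hP
  have hρ : ρ i = 0 := by
    simpa [P, Y, Z, hij, hik, hjk, hjk.symm] using hev
  exact hri (congrArg Subtype.val hρ)

theorem stmt11 (n : ℕ) (hn : 5 ≤ n) (G : SimpleGraph (Fin n))
    (α β : ℚ) (hα : 1 < α) (hβ : α < β)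
    (r : Fin n → ℝ) (hr : ∀ i, 0 < r i)
    (p q : Fin n → Fin 3 → ℝ)
    (hp : ∀ i, (p i 0) ^ 2 + (α : ℝ) * (p i 1) ^ 2 + (β : ℝ) * (p i 2) ^ 2 = r i)
    (hq : ∀ i, (q i 0) ^ 2 + (α : ℝ) * (q i 1) ^ 2 + (β : ℝ) * (q i 2) ^ 2 = r i)
    (hgen : IsGenericConf n r p)
    (hequiv : ∀ i j, G.Adj i j →
      ∑ a, (p i a - p j a) ^ 2 = ∑ a, (q i a - q j a) ^ 2)
    (a d e : ℝ)
    (haff : ∀ i, q i 0 = a * p i 0 ∧ q i 1 = d * p i 1 ∧ q i 2 = e * p i 2) :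
    ∀ i j, ∑ x, (p i x - p j x) ^ 2 = ∑ x, (q i x - q j x) ^ 2 := by
  let i₀ : Fin n := ⟨0, by omega⟩
  let i₁ : Fin n := ⟨1, by omega⟩
  let i₂ : Fin n := ⟨2, by omega⟩
  have hdet := hgen.det_ne_zero α β hp (i := i₀) (j := i₁) (k := i₂) (by simp [i₀, i₁])
    (by simp [i₀, i₂]) (by simp [i₁, i₂]) (hr i₀).ne'
  have hαpos : (0 : ℝ) < α := by exact_mod_cast one_pos.trans hα
  have hβpos : (0 : ℝ) < β := by exact_mod_cast (one_pos.trans hα).trans hβ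
  have hlin : ∀ i, (a ^ 2 - 1) * r i + α * (d ^ 2 - a ^ 2) * p i 1 ^ 2
      + β * (e ^ 2 - a ^ 2) * p i 2 ^ 2 = 0 := by
    intro i
    have h := hq i
    obtain ⟨h0, h1, h2⟩ := haff i
    rw [h0, h1, h2] at h
    linear_combination h - a ^ 2 * hp i
  have e₀ := hlin i₀
  have e₁ := hlin i₁
  have e₂ := hlin i₂
  have ha : a ^ 2 - 1 = 0 := by
    refine (mul_eq_zero.mp ?_).resolve_right hdet
    linear_combination
      (p i₁ 1 ^ 2 * p i₂ 2 ^ 2 - p i₂ 1 ^ 2 * p i₁ 2 ^ 2) * e₀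
      - (p i₀ 1 ^ 2 * p i₂ 2 ^ 2 - p i₂ 1 ^ 2 * p i₀ 2 ^ 2) * e₁
      + (p i₀ 1 ^ 2 * p i₁ 2 ^ 2 - p i₁ 1 ^ 2 * p i₀ 2 ^ 2) * e₂
  have hd : (α : ℝ) * (d ^ 2 - a ^ 2) = 0 := by
    refine (mul_eq_zero.mp ?_).resolve_right hdet
    linear_combination
      -(r i₁ * p i₂ 2 ^ 2 - r i₂ * p i₁ 2 ^ 2) * e₀
      + (r i₀ * p i₂ 2 ^ 2 - r i₂ * p i₀ 2 ^ 2) * e₁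
      - (r i₀ * p i₁ 2 ^ 2 - r i₁ * p i₀ 2 ^ 2) * e₂
  have he : (β : ℝ) * (e ^ 2 - a ^ 2) = 0 := by
    refine (mul_eq_zero.mp ?_).resolve_right hdet
    linear_combination
      (r i₁ * p i₂ 1 ^ 2 - r i₂ * p i₁ 1 ^ 2) * e₀
      - (r i₀ * p i₂ 1 ^ 2 - r i₂ * p i₀ 1 ^ 2) * e₁
      + (r i₀ * p i₁ 1 ^ 2 - r i₁ * p i₀ 1 ^ 2) * e₂
  have hd' : d ^ 2 - a ^ 2 = 0 := (mul_eq_zero.mp hd).resolve_left hαpos.ne'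
  have he' : e ^ 2 - a ^ 2 = 0 := (mul_eq_zero.mp he).resolve_left hβpos.ne'
  intro i j
  obtain ⟨h0, h1, h2⟩ := haff i
  obtain ⟨k0, k1, k2⟩ := haff j
  simp only [Fin.sum_univ_three, h0, h1, h2, k0, k1, k2]
  linear_combination (-(p i 0 - p j 0) ^ 2) * ha - (p i 1 - p j 1) ^ 2 * (hd' + ha)
    - (p i 2 - p j 2) ^ 2 * (he' + ha)
end

section
/- Let p be a generic point of ℝ^{3n} with n ≥ 5, let G be a graph on vertices v_1,...,v_n, and let E = E^p be the family of concentric ellipsoids induced by p. Let (ω,λ) be an equilibrium stress for (G,p) on E, and let (G,q) be a framework on E which is equivalent to (G,p). Then (ω,λ) is an equilibrium stress for (G,q) on E. Furthermore, if rank Ω_E(ω,λ) = 3n − 3, then (G,p) is globally rigid on E. -/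
open Finset

/-- Let `A` be a domain embedded in a field `L` of characteristic zero. A map from `A` to a nilpotent
thickening `B` of `L` that lifts the embedding extends to a section `L →+* B`. -/
lemma exists_ringHom_lift_of_charZero {A L B : Type*} [CommRing A] [IsDomain A] [Field L]
    [CharZero L] [CommRing B] (i : A →+* L) (hi : Function.Injective i)
    (ρ : A →+* B) (π : B →+* L) (hπ : Function.Surjective π)
    (hker : IsNilpotent (RingHom.ker π)) (hρ : ∀ a, π (ρ a) = i a) :
    ∃ g : L →+* B, (∀ x, π (g x) = x) ∧ ∀ a, g (i a) = ρ a := by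
  let _ : Algebra A L := i.toAlgebra
  let _ : Algebra A B := ρ.toAlgebra
  have : FaithfulSMul A L := (faithfulSMul_iff_algebraMap_injective A L).mpr hi
  let _ : Algebra (FractionRing A) L := FractionRing.liftAlgebra A L
  have : CharZero (FractionRing A) :=
    (algebraMap (FractionRing A) L).charZero
  have : Algebra.FormallySmooth A (FractionRing A) :=
    .of_isLocalization (nonZeroDivisors A)
  have : Algebra.FormallySmooth (FractionRing A) L := by
    obtain ⟨s, hs⟩ := exists_isTranscendenceBasis (FractionRing A) L
    have := hs.isAlgebraic_field
    exact .of_algebraicIndependent_of_isSeparable hs.1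
  have : Algebra.FormallySmooth A L := .comp A (FractionRing A) L
  let π' : B →ₐ[A] L := { π with commutes' := hρ }
  let g : L →ₐ[A] B := Algebra.FormallySmooth.liftOfSurjective (AlgHom.id A L) π' hπ hker
  exact ⟨g, Algebra.FormallySmooth.liftOfSurjective_apply (AlgHom.id A L) π' hπ hker, g.commutes⟩

open MvPolynomial in
/-- If `p` is generic and a rational polynomial map `f` takes the same value at `p` and `q`, then
every tangent vector at `q` has the same image under `df` as some tangent vector at `p`. Tangent
vectors are encoded as points over the dual numbers. -/
lemma exists_dualNumber_point_aeval_eq {σ ι : Type*} (f : ι → MvPolynomial σ ℚ) (p : σ → ℝ)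
    (hp : AlgebraicIndependent ℚ p) (Q : σ → DualNumber ℝ)
    (h : ∀ i, aeval (fun s => (Q s).fst) (f i) = aeval p (f i)) :
    ∃ P : σ → DualNumber ℝ, (∀ s, (P s).fst = p s) ∧ ∀ i, aeval P (f i) = aeval Q (f i) := by
  let A := (aeval f : MvPolynomial ι ℚ →ₐ[ℚ] MvPolynomial σ ℚ).range
  let π : DualNumber ℝ →+* ℝ := (TrivSqZeroExt.fstHom ℝ ℝ ℝ : DualNumber ℝ →ₐ[ℝ] ℝ)
  have hcomp : ∀ x, π (aeval Q x) = aeval (fun s => (Q s).fst) x := fun x => by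
    have := MvPolynomial.comp_aeval_apply (f := Q) (φ := RingHom.toRatAlgHom π) x
    exact this
  obtain ⟨g, hg, hgA⟩ := exists_ringHom_lift_of_charZero
    (A := A) (((aeval p : MvPolynomial σ ℚ →ₐ[ℚ] ℝ).comp A.val : A →ₐ[ℚ] ℝ) : A →+* ℝ)
    (Function.Injective.comp (g := aeval p) hp Subtype.val_injective)
    (((aeval Q : MvPolynomial σ ℚ →ₐ[ℚ] DualNumber ℝ).comp A.val : A →ₐ[ℚ] _) : A →+* _)
    π (fun x => ⟨TrivSqZeroExt.inl x, rfl⟩) ⟨2, TrivSqZeroExt.kerIdeal_sq ℝ ℝ⟩ (by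
      rintro ⟨_, y, rfl⟩
      refine (hcomp _).trans ?_
      change aeval _ (aeval f y) = aeval p (aeval f y)
      rw [comp_aeval_apply, comp_aeval_apply]
      simp only [h])
  refine ⟨fun s => g (p s), fun s => hg (p s), fun i => ?_⟩
  have h1 : aeval (fun s => g (p s)) (f i) = g (aeval p (f i)) :=
    (comp_aeval_apply (f := p) (φ := RingHom.toRatAlgHom g) (f i)).symm
  rw [h1]
  exact hgA ⟨f i, X i, by simp⟩

lemma sum_mul_stress_force {n : ℕ} {ω : Fin n → Fin n → ℝ} (hω : ∀ i j, ω i j = ω j i)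
    (c : Fin 3 → ℝ) (lam : Fin n → ℝ) (p w : Fin n → Fin 3 → ℝ) :
    2 * ∑ i, ∑ a, w i a * ((∑ j, ω i j * (p i a - p j a)) + lam i * (c a * p i a)) =
      ∑ i, ∑ j, ω i j * ∑ a, (p i a - p j a) * (w i a - w j a) +
        2 * ∑ i, lam i * ∑ a, c a * p i a * w i a := by
  have key : ∑ i, ∑ j, ω i j * ∑ a, (p i a - p j a) * w j a =
      - ∑ i, ∑ j, ω i j * ∑ a, (p i a - p j a) * w i a := by
    rw [Finset.sum_comm, ← Finset.sum_neg_distrib]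
    refine Finset.sum_congr rfl fun i _ => ?_
    rw [← Finset.sum_neg_distrib]
    refine Finset.sum_congr rfl fun j _ => ?_
    rw [hω j i, ← mul_neg, ← Finset.sum_neg_distrib]
    congr 1
    exact Finset.sum_congr rfl fun a _ => by ring
  have h1 : ∑ i, ∑ j, ω i j * ∑ a, (p i a - p j a) * (w i a - w j a) =
      2 * ∑ i, ∑ j, ω i j * ∑ a, (p i a - p j a) * w i a := by
    simp only [mul_sub, Finset.sum_sub_distrib] at key ⊢
    simp only [mul_sub, sub_mul, Finset.sum_sub_distrib] at key ⊢
    linarith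
  have h2 : ∑ i, ∑ a, w i a * ((∑ j, ω i j * (p i a - p j a)) + lam i * (c a * p i a)) =
      ∑ i, ∑ j, ω i j * ∑ a, (p i a - p j a) * w i a +
        ∑ i, lam i * ∑ a, c a * p i a * w i a := by
    rw [← Finset.sum_add_distrib]
    refine Finset.sum_congr rfl fun i _ => ?_
    simp only [mul_add, Finset.sum_add_distrib, Finset.mul_sum]
    rw [Finset.sum_comm]
    congr 1
    · exact Finset.sum_congr rfl fun j _ => Finset.sum_congr rfl fun a _ => by ring
    · exact Finset.sum_congr rfl fun a _ => by ring
  rw [h1, h2]; ring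

lemma sum_ellCoeff_mul {α β : ℚ} (x : Fin 3 → ℝ) :
    ∑ a, ellCoeff α β a * x a = x 0 + (α : ℝ) * x 1 + (β : ℝ) * x 2 := by
  simp [Fin.sum_univ_three, ellCoeff]

open MvPolynomial in
/-- Equilibrium stresses of a generic framework are equilibrium stresses of every equivalent
framework on the same family of ellipsoids. -/
theorem isEquilStressE_of_equivalent {n : ℕ} {G : SimpleGraph (Fin n)} {α β : ℚ}
    {p q : Fin n → Fin 3 → ℝ}
    (hgen : AlgebraicIndependent ℚ (fun c : Fin n × Fin 3 => p c.1 c.2))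
    {ω : Fin n → Fin n → ℝ} {lam : Fin n → ℝ} (hω : IsStress G ω)
    (hequilp : IsEquilStressE α β p ω lam)
    (hq : ∀ i, (q i 0) ^ 2 + (α : ℝ) * (q i 1) ^ 2 + (β : ℝ) * (q i 2) ^ 2 =
          (p i 0) ^ 2 + (α : ℝ) * (p i 1) ^ 2 + (β : ℝ) * (p i 2) ^ 2)
    (hequiv : ∀ i j, G.Adj i j →
      ∑ a, (p i a - p j a) ^ 2 = ∑ a, (q i a - q j a) ^ 2) :
    IsEquilStressE α β q ω lam := by
  let v : Fin n → Fin 3 → ℝ := fun i a =>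
    (∑ j, ω i j * (q i a - q j a)) + lam i * (ellCoeff α β a * q i a)
  let fE : {e : Fin n × Fin n // G.Adj e.1 e.2} → MvPolynomial (Fin n × Fin 3) ℚ :=
    fun e => ∑ a, (X (e.1.1, a) - X (e.1.2, a)) ^ 2
  let fV : Fin n → MvPolynomial (Fin n × Fin 3) ℚ :=
    fun i => X (i, 0) ^ 2 + C α * X (i, 1) ^ 2 + C β * X (i, 2) ^ 2
  let Q : Fin n × Fin 3 → DualNumber ℝ :=
    fun c => TrivSqZeroExt.inl (q c.1 c.2) + TrivSqZeroExt.inr (v c.1 c.2)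
  obtain ⟨P, hP, hPQ⟩ := exists_dualNumber_point_aeval_eq (Sum.elim fE fV) _ hgen Q (by
    rintro (⟨⟨i, j⟩, hij⟩ | i)
    · simpa [fE, Q] using (hequiv i j hij).symm
    · simpa [fV, Q] using hq i)
  have hedge : ∀ i j, ω i j * ∑ a, (p i a - p j a) * ((P (i, a)).snd - (P (j, a)).snd) =
      ω i j * ∑ a, (q i a - q j a) * (v i a - v j a) := by
    intro i j
    by_cases hij : G.Adj i j
    · have h := congrArg TrivSqZeroExt.snd (hPQ (Sum.inl ⟨(i, j), hij⟩))
      simp [fE, Q, hP, Fin.sum_univ_three, pow_two] at h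
      rw [Fin.sum_univ_three, Fin.sum_univ_three]
      congr 1
      linarith
    · simp [hω.2 i j hij]
  have hvert : ∀ i, ∑ a, ellCoeff α β a * p i a * (P (i, a)).snd =
      ∑ a, ellCoeff α β a * q i a * v i a := by
    intro i
    have h := congrArg TrivSqZeroExt.snd (hPQ (Sum.inr i))
    have halg : ∀ r : ℚ, algebraMap ℚ (DualNumber ℝ) r = TrivSqZeroExt.inl (r : ℝ) := fun _ => rfl
    simp [fV, Q, hP, pow_two, halg] at h
    simp only [mul_assoc, sum_ellCoeff_mul]
    linarith
  have hp0 := sum_mul_stress_force hω.1 (ellCoeff α β) lam p (fun i a => (P (i, a)).snd)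
  have hq0 := sum_mul_stress_force hω.1 (ellCoeff α β) lam q v
  simp only [hedge, hvert, hequilp _ _, mul_zero, Finset.sum_const_zero] at hp0
  rw [← hp0] at hq0
  have hsum : ∑ i, ∑ a, v i a * v i a = 0 := by simpa using hq0
  intro i a
  rw [Finset.sum_eq_zero_iff_of_nonneg
    fun i _ => Finset.sum_nonneg fun a _ => mul_self_nonneg _] at hsum
  have h1 := hsum i (Finset.mem_univ i)
  rw [Finset.sum_eq_zero_iff_of_nonneg fun a _ => mul_self_nonneg _] at h1
  exact mul_self_eq_zero.mp (h1 a (Finset.mem_univ a))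

lemma omegaMat_mulVec_apply {n : ℕ} {ω : Fin n → Fin n → ℝ} (hω : ∀ i, ω i i = 0)
    (x : Fin n → ℝ) (i : Fin n) :
    ∑ j, omegaMat ω i j * x j = ∑ j, ω i j * (x i - x j) := by
  have h : ∀ j, omegaMat ω i j * x j =
      (if i = j then (∑ k, ω i k) * x i else 0) - ω i j * x j := by
    intro j
    by_cases hij : i = j
    · subst hij; simp [omegaMat, hω]
    · simp [omegaMat, hij]
  simp only [h, Finset.sum_sub_distrib, mul_sub, Finset.sum_ite_eq, Finset.mem_univ, if_true,
    Finset.sum_mul]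

lemma stressMatE_mulVec_apply {n : ℕ} (α β : ℚ) {ω : Fin n → Fin n → ℝ} (hω : ∀ i, ω i i = 0)
    (lam : Fin n → ℝ) (x : Fin 3 × Fin n → ℝ) (a : Fin 3) (i : Fin n) :
    (stressMatE α β ω lam).mulVec x (a, i) =
      (∑ j, ω i j * (x (a, i) - x (a, j))) + lam i * (ellCoeff α β a * x (a, i)) := by
  rw [← omegaMat_mulVec_apply hω fun j => x (a, j)]
  simp only [Matrix.mulVec, dotProduct, stressMatE, Fintype.sum_prod_type, ite_mul, zero_mul,
    add_mul]
  rw [Finset.sum_eq_single a (by intro b _ hb; simp [hb.symm]) (by simp)]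
  simp [Finset.sum_add_distrib]
  ring

lemma stressMatE_mulVec_configMatE {n : ℕ} {α β : ℚ} {ω : Fin n → Fin n → ℝ}
    (hω : ∀ i, ω i i = 0) {lam : Fin n → ℝ} {p : Fin n → Fin 3 → ℝ}
    (hp : IsEquilStressE α β p ω lam) (a : Fin 3) :
    (stressMatE α β ω lam).mulVec (configMatE p a) = 0 := by
  ext ⟨b, i⟩
  rw [stressMatE_mulVec_apply α β hω]
  by_cases hb : b = a
  · subst hb; simpa [configMatE] using hp i b
  · simp [configMatE, hb]

/-- If the stress matrix has maximal rank, every framework with the same equilibrium stress is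
obtained by scaling the coordinate axes. -/
lemma exists_scaling_of_rank_eq {n : ℕ} {α β : ℚ} {ω : Fin n → Fin n → ℝ}
    (hω : ∀ i, ω i i = 0) {lam : Fin n → ℝ} {p q : Fin n → Fin 3 → ℝ}
    (hp : IsEquilStressE α β p ω lam) (hq : IsEquilStressE α β q ω lam)
    (hp0 : ∀ a, ∃ i, p i a ≠ 0) (hrank : (stressMatE α β ω lam).rank = 3 * n - 3) :
    ∃ c : Fin 3 → ℝ, ∀ i a, q i a = c a * p i a := by
  have hn : 1 ≤ n := by
    obtain ⟨i, -⟩ := hp0 0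
    exact i.pos
  have hli : LinearIndependent ℝ (fun a => configMatE p a) := by
    rw [Fintype.linearIndependent_iff]
    intro g hg a
    obtain ⟨i, hi⟩ := hp0 a
    have := congrFun hg (a, i)
    simpa [configMatE, Finset.sum_apply, hi] using this
  have hle : Submodule.span ℝ (Set.range fun a => configMatE p a) ≤
      LinearMap.ker (stressMatE α β ω lam).mulVecLin := by
    rw [Submodule.span_le]
    rintro _ ⟨a, rfl⟩
    exact stressMatE_mulVec_configMatE hω hp a
  have hdim := (stressMatE α β ω lam).mulVecLin.finrank_range_add_finrank_ker
  have heq : Submodule.span ℝ (Set.range fun a => configMatE p a) =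
      LinearMap.ker (stressMatE α β ω lam).mulVecLin := by
    refine Submodule.eq_of_le_of_finrank_eq hle ?_
    rw [finrank_span_eq_card hli]
    rw [Matrix.rank] at hrank
    rw [hrank] at hdim
    simp at hdim ⊢
    omega
  have hmem : (fun x : Fin 3 × Fin n => q x.2 x.1) ∈
      Submodule.span ℝ (Set.range fun a => configMatE p a) := by
    rw [heq, LinearMap.mem_ker, Matrix.mulVecLin_apply]
    ext ⟨a, i⟩
    rw [stressMatE_mulVec_apply α β hω]
    exact hq i a
  rw [Submodule.mem_span_range_iff_exists_fun] at hmem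
  obtain ⟨c, hc⟩ := hmem
  refine ⟨c, fun i a => ?_⟩
  have := congrFun hc (a, i)
  simpa [configMatE, Finset.sum_apply] using this.symm

open MvPolynomial in
/-- The squared coordinate vectors of at least three generic points of `ℝ³` span `ℝ³`. -/
lemma eq_zero_of_forall_sum_mul_sq_eq_zero {n : ℕ} (hn : 3 ≤ n) {p : Fin n → Fin 3 → ℝ}
    (hgen : AlgebraicIndependent ℚ (fun c : Fin n × Fin 3 => p c.1 c.2)) {d : Fin 3 → ℝ}
    (hd : ∀ i, ∑ a, p i a ^ 2 * d a = 0) : d = 0 := by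
  let e : Fin 3 → Fin n := Fin.castLE hn
  let M : Matrix (Fin 3) (Fin 3) (MvPolynomial (Fin n × Fin 3) ℚ) :=
    Matrix.of fun i a => X (e i, a) ^ 2
  have hM : M.det ≠ 0 := by
    intro h
    have h1 := congrArg (aeval fun c : Fin n × Fin 3 => if c.1 = e c.2 then (1 : ℚ) else 0) h
    rw [AlgHom.map_det] at h1
    have : (aeval fun c : Fin n × Fin 3 => if c.1 = e c.2 then (1 : ℚ) else 0).mapMatrix M
        = 1 := by
      ext i a
      have he : e i = e a ↔ i = a := (Fin.castLE_injective hn).eq_iff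
      simp [M, Matrix.one_apply, he]
    rw [this] at h1
    simp at h1
  have hdet : (Matrix.of fun i a => p (e i) a ^ 2 : Matrix (Fin 3) (Fin 3) ℝ).det ≠ 0 := by
    intro h
    refine hM (hgen.eq_zero_of_aeval_eq_zero _ ?_)
    rw [AlgHom.map_det, ← h]
    congr 1
    ext i a
    simp [M]
  refine Matrix.eq_zero_of_mulVec_eq_zero hdet ?_
  ext i
  simpa [Matrix.mulVec, dotProduct] using hd (e i)

theorem stmt13 (n : ℕ) (hn : 5 ≤ n) (G : SimpleGraph (Fin n))
    (α β : ℚ) (hα : 1 < α) (hβ : α < β)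
    (p : Fin n → Fin 3 → ℝ)
    (hgen : AlgebraicIndependent ℚ (fun c : Fin n × Fin 3 => p c.1 c.2))
    (ω : Fin n → Fin n → ℝ) (lam : Fin n → ℝ) (hω : IsStress G ω)
    (hequilp : IsEquilStressE α β p ω lam)
    (q : Fin n → Fin 3 → ℝ)
    (hq : ∀ i, (q i 0) ^ 2 + (α : ℝ) * (q i 1) ^ 2 + (β : ℝ) * (q i 2) ^ 2 =
          (p i 0) ^ 2 + (α : ℝ) * (p i 1) ^ 2 + (β : ℝ) * (p i 2) ^ 2)
    (hequiv : ∀ i j, G.Adj i j →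
      ∑ a, (p i a - p j a) ^ 2 = ∑ a, (q i a - q j a) ^ 2) :
    IsEquilStressE α β q ω lam ∧
    ((stressMatE α β ω lam).rank = 3 * n - 3 →
      ∀ q' : Fin n → Fin 3 → ℝ,
        (∀ i, (q' i 0) ^ 2 + (α : ℝ) * (q' i 1) ^ 2 + (β : ℝ) * (q' i 2) ^ 2 =
              (p i 0) ^ 2 + (α : ℝ) * (p i 1) ^ 2 + (β : ℝ) * (p i 2) ^ 2) →
        (∀ i j, G.Adj i j →
          ∑ a, (p i a - p j a) ^ 2 = ∑ a, (q' i a - q' j a) ^ 2) →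
        ∀ i j, ∑ a, (p i a - p j a) ^ 2 = ∑ a, (q' i a - q' j a) ^ 2) := by
  refine ⟨isEquilStressE_of_equivalent hgen hω hequilp hq hequiv, fun hrank q' hq' hequiv' => ?_⟩
  have hω0 : ∀ i, ω i i = 0 := fun i => hω.2 i i (G.loopless.irrefl i)
  obtain ⟨c, hc⟩ := exists_scaling_of_rank_eq hω0 hequilp
    (isEquilStressE_of_equivalent hgen hω hequilp hq' hequiv')
    (fun a => ⟨⟨0, by omega⟩, hgen.ne_zero (⟨0, by omega⟩, a)⟩) hrank
  have hd := eq_zero_of_forall_sum_mul_sq_eq_zero (by omega) hgen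
    (d := fun a => ellCoeff α β a * (c a ^ 2 - 1)) fun i => by
      have h := hq' i
      simp only [hc] at h
      simp [Fin.sum_univ_three, ellCoeff]
      linarith
  have hcoeff : ∀ a, ellCoeff α β a ≠ 0 := by
    have hα' : (α : ℝ) ≠ 0 := by exact_mod_cast (by linarith : 0 < α).ne'
    have hβ' : (β : ℝ) ≠ 0 := by exact_mod_cast (by linarith : 0 < β).ne'
    intro a
    unfold ellCoeff
    split_ifs <;> first | exact one_ne_zero | assumption
  have hc2 : ∀ a, c a ^ 2 = 1 := fun a =>
    sub_eq_zero.mp ((mul_eq_zero.mp (congrFun hd a)).resolve_left (hcoeff a))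
  intro i j
  refine Finset.sum_congr rfl fun a _ => ?_
  rw [hc, hc, ← mul_sub, mul_pow, hc2, one_mul]
end

section
/- Suppose (G,p) is a framework on some family of concentric cylinders Y which is infinitesimally rigid on Y, i.e. rank R_Y(G,p) = 3n − 2. Then for every generic point q of ℝ^{3n}, the framework (G,q) is infinitesimally rigid on the induced family of concentric cylinders Y^q, i.e. rank R_{Y^q}(G,q) = 3n − 2. -/
open Finset

/-- The rigidity matrix `R_Y(G,p)` of a framework on a family of concentric cylinders:
rows indexed by (potential) edges and by vertices, columns by `Fin 3 × Fin n`
(coordinate block × vertex).  The row of an edge `v_iv_j` carries `p_i − p_j` in the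
columns of `v_i` and `p_j − p_i` in the columns of `v_j`; the row of a vertex `v_i`
carries `(x_i, y_i, 0)` in the columns of `v_i`.  Rows indexed by non-edges are zero. -/
def rigidityMatY {n : ℕ} (G : SimpleGraph (Fin n)) [DecidableRel G.Adj]
    (p : Fin n → Fin 3 → ℝ) : Matrix (Sym2 (Fin n) ⊕ Fin n) (Fin 3 × Fin n) ℝ :=
  fun row c =>
    match row with
    | Sum.inl e =>
        if e ∈ G.edgeSet then
          if h : c.2 ∈ e then p c.2 c.1 - p (Sym2.Mem.other' h) c.1 else 0
        else 0
    | Sum.inr i => if c.2 = i ∧ c.1 ≠ 2 then p i c.1 else 0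

/-- A matrix of rank `k` over a field has `k` linearly independent rows. -/
lemma Matrix.exists_linearIndependent_submatrix_row {m n K : Type*} [Finite m] [Fintype n]
    [Field K] (A : Matrix m n K) :
    ∃ f : Fin A.rank → m, LinearIndependent K (A.submatrix f id).row := by
  obtain ⟨g, hg, -, hli⟩ :=
    Submodule.exists_fun_fin_finrank_span_eq K (Set.range A.row)
  rw [A.rank_eq_finrank_span_row]
  choose f hf using hg
  exact ⟨f, (funext hf : (A.submatrix f id).row = g) ▸ hli⟩

open scoped Matrix in
/-- The rank of a matrix of rational polynomials, evaluated at an algebraically independent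
real point, is at least its rank at any other real point. -/
lemma Matrix.rank_map_aeval_le_of_algebraicIndependent {σ m n : Type*} [Finite m] [Fintype n]
    (M : Matrix m n (MvPolynomial σ ℚ)) (x y : σ → ℝ) (hy : AlgebraicIndependent ℚ y) :
    (M.map (MvPolynomial.aeval x)).rank ≤ (M.map (MvPolynomial.aeval y)).rank := by
  obtain ⟨f, hf⟩ := (M.map (MvPolynomial.aeval x)).exists_linearIndependent_submatrix_row
  generalize (M.map (MvPolynomial.aeval x)).rank = k at f hf
  set N := M.submatrix f id with hN
  have gram (z : σ → ℝ) : MvPolynomial.aeval z (N * Nᵀ).det =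
      (N.map (MvPolynomial.aeval z) * (N.map (MvPolynomial.aeval z))ᵀ).det := by
    rw [AlgHom.map_det, AlgHom.mapMatrix_apply, Matrix.map_mul, Matrix.transpose_map]
  have hx : MvPolynomial.aeval x (N * Nᵀ).det ≠ 0 := by
    rw [gram, ← isUnit_iff_ne_zero, ← Matrix.isUnit_iff_isUnit_det,
      ← Matrix.linearIndependent_rows_iff_isUnit, linearIndependent_iff_card_eq_finrank_span,
      Set.finrank, ← Matrix.rank_eq_finrank_span_row, Matrix.rank_self_mul_transpose]
    exact (LinearIndependent.rank_matrix hf).symm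
  have hy' : MvPolynomial.aeval y (N * Nᵀ).det ≠ 0 := fun h =>
    hx (by rw [algebraicIndependent_iff.1 hy _ h, map_zero])
  rw [gram, ← isUnit_iff_ne_zero, ← Matrix.isUnit_iff_isUnit_det] at hy'
  have hrank := Matrix.rank_of_isUnit _ hy'
  rw [Matrix.rank_self_mul_transpose, Fintype.card_fin] at hrank
  rw [← hrank]
  exact Matrix.rank_submatrix_le (M.map (MvPolynomial.aeval y)) f id

/-- The rigidity matrix at indeterminate coordinates. -/
noncomputable def polyRigidityMatY {n : ℕ} (G : SimpleGraph (Fin n)) [DecidableRel G.Adj] :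
    Matrix (Sym2 (Fin n) ⊕ Fin n) (Fin 3 × Fin n) (MvPolynomial (Fin n × Fin 3) ℚ) :=
  fun row c =>
    match row with
    | Sum.inl e =>
        if e ∈ G.edgeSet then
          if h : c.2 ∈ e then MvPolynomial.X (c.2, c.1) - MvPolynomial.X (Sym2.Mem.other' h, c.1)
          else 0
        else 0
    | Sum.inr i => if c.2 = i ∧ c.1 ≠ 2 then MvPolynomial.X (i, c.1) else 0

lemma map_aeval_polyRigidityMatY {n : ℕ} (G : SimpleGraph (Fin n)) [DecidableRel G.Adj]
    (p : Fin n → Fin 3 → ℝ) :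
    (polyRigidityMatY G).map (MvPolynomial.aeval fun c : Fin n × Fin 3 => p c.1 c.2) =
      rigidityMatY G p := by
  ext (e | i) c
  · simp only [Matrix.map_apply, polyRigidityMatY, rigidityMatY]
    split_ifs <;> simp
  · simp only [Matrix.map_apply, polyRigidityMatY, rigidityMatY]
    split_ifs <;> simp

lemma rigidityMatY_mulVec_edge {n : ℕ} (G : SimpleGraph (Fin n)) [DecidableRel G.Adj]
    (p : Fin n → Fin 3 → ℝ) (w : Fin 3 × Fin n → ℝ) {i j : Fin n} (hij : G.Adj i j) :
    (rigidityMatY G p).mulVec w (Sum.inl s(i, j)) =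
      ∑ k, (p i k - p j k) * (w (k, i) - w (k, j)) := by
  rw [Matrix.mulVec, dotProduct, Fintype.sum_prod_type]
  refine Finset.sum_congr rfl fun k _ => ?_
  rw [Fintype.sum_eq_add i j hij.ne]
  · have hi : i ∈ s(i, j) := Sym2.mem_mk_left i j
    have hj : j ∈ s(i, j) := Sym2.mem_mk_right i j
    have hi' : Sym2.Mem.other' hi = j := Sym2.congr_right.1 (Sym2.other_spec' hi)
    have hj' : Sym2.Mem.other' hj = i :=
      Sym2.congr_right.1 ((Sym2.other_spec' hj).trans Sym2.eq_swap)
    simp only [rigidityMatY, SimpleGraph.mem_edgeSet, hij, if_true, dif_pos hi, dif_pos hj,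
      hi', hj']
    ring
  · rintro v ⟨hvi, hvj⟩
    simp [rigidityMatY, hvi, hvj]

lemma rigidityMatY_mulVec_vertex {n : ℕ} (G : SimpleGraph (Fin n)) [DecidableRel G.Adj]
    (p : Fin n → Fin 3 → ℝ) (w : Fin 3 × Fin n → ℝ) (i : Fin n) :
    (rigidityMatY G p).mulVec w (Sum.inr i) = p i 0 * w (0, i) + p i 1 * w (1, i) := by
  simp [Matrix.mulVec, dotProduct, Fintype.sum_prod_type, Fin.sum_univ_three, rigidityMatY]

lemma rigidityMatY_mulVec_eq_zero_iff {n : ℕ} (G : SimpleGraph (Fin n)) [DecidableRel G.Adj]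
    (p : Fin n → Fin 3 → ℝ) (w : Fin 3 × Fin n → ℝ) :
    (rigidityMatY G p).mulVec w = 0 ↔
      (∀ i j, G.Adj i j → ∑ k, (p i k - p j k) * (w (k, i) - w (k, j)) = 0) ∧
        ∀ i, p i 0 * w (0, i) + p i 1 * w (1, i) = 0 := by
  refine ⟨fun h => ⟨fun i j hij => ?_, fun i => ?_⟩, fun h => ?_⟩
  · rw [← rigidityMatY_mulVec_edge G p w hij, h, Pi.zero_apply]
  · rw [← rigidityMatY_mulVec_vertex G p w i, h, Pi.zero_apply]
  · ext (e | i)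
    · induction e with | _ i j
      by_cases hij : G.Adj i j
      · rw [rigidityMatY_mulVec_edge G p w hij, h.1 i j hij, Pi.zero_apply]
      · simp [Matrix.mulVec, dotProduct, rigidityMatY, hij]
    · rw [rigidityMatY_mulVec_vertex, h.2 i, Pi.zero_apply]

/-- Translation along the axis and rotation about it span a two-dimensional space of trivial
infinitesimal motions as soon as some vertex lies off the axis. -/
lemma rank_rigidityMatY_le {n : ℕ} (G : SimpleGraph (Fin n)) [DecidableRel G.Adj]
    (p : Fin n → Fin 3 → ℝ) (i : Fin n) (hi : p i 0 ≠ 0) :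
    (rigidityMatY G p).rank ≤ 3 * n - 2 := by
  let t : Fin 3 × Fin n → ℝ := fun c => ![0, 0, 1] c.1
  let s : Fin 3 × Fin n → ℝ := fun c => ![-p c.2 1, p c.2 0, 0] c.1
  have ht : (rigidityMatY G p).mulVec t = 0 := by
    rw [rigidityMatY_mulVec_eq_zero_iff]
    simp [t]
  have hs : (rigidityMatY G p).mulVec s = 0 := by
    rw [rigidityMatY_mulVec_eq_zero_iff]
    refine ⟨fun a b _ => ?_, fun a => ?_⟩
    · simp only [s, Fin.sum_univ_three, Matrix.cons_val]
      ring
    · simp only [s, Matrix.cons_val]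
      ring
  have hli : LinearIndependent ℝ ![t, s] := by
    rw [LinearIndependent.pair_iff]
    intro a b hab
    have h1 := congrFun hab (1, i)
    have h2 := congrFun hab (2, i)
    simp [t, s, hi] at h1 h2
    exact ⟨h2, h1⟩
  have hspan : Submodule.span ℝ (Set.range ![t, s]) ≤
      LinearMap.ker (rigidityMatY G p).mulVecLin := by
    rw [Submodule.span_le, Set.range_subset_iff]
    intro a
    fin_cases a
    · simpa using ht
    · simpa using hs
  have hker := Submodule.finrank_mono hspan
  rw [finrank_span_eq_card hli, Fintype.card_fin] at hker
  have hnull := LinearMap.finrank_range_add_finrank_ker (rigidityMatY G p).mulVecLin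
  rw [Module.finrank_fintype_fun_eq_card, Fintype.card_prod, Fintype.card_fin,
    Fintype.card_fin] at hnull
  rw [Matrix.rank]
  omega

theorem stmt15 (n : ℕ) (G : SimpleGraph (Fin n)) [DecidableRel G.Adj]
    (r : Fin n → ℝ) (hr : ∀ i, 0 < r i)
    (p : Fin n → Fin 3 → ℝ) (hp : ∀ i, (p i 0) ^ 2 + (p i 1) ^ 2 = r i)
    (hrig : (rigidityMatY G p).rank = 3 * n - 2)
    (q : Fin n → Fin 3 → ℝ)
    (hgen : AlgebraicIndependent ℚ (fun c : Fin n × Fin 3 => q c.1 c.2)) :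
    (rigidityMatY G q).rank = 3 * n - 2 := by
  refine le_antisymm ?_ ?_
  · rcases Nat.eq_zero_or_pos n with rfl | hn
    · simpa using (rigidityMatY G q).rank_le_card_width
    · exact rank_rigidityMatY_le G q ⟨0, hn⟩ (hgen.ne_zero (⟨0, hn⟩, 0))
  · rw [← hrig, ← map_aeval_polyRigidityMatY G p, ← map_aeval_polyRigidityMatY G q]
    exact (polyRigidityMatY G).rank_map_aeval_le_of_algebraicIndependent _ _ hgen
end
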